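/- arXiv:math/0610608 — 3 statements merged into one kernel-verified Lean document; each statement's English description precedes it below -/
import Mathlib

section
/- Let u, v ≥ 0 and m ≥ 1 be integers, and let X = {u+2, u+4, u+6, …, u+2m}. Then for all s ≥ 0, the number P_{2m+u+v,s}^{X} of permutations of {1,…,2m+u+v} with exactly s descents whose top lies in X equals C(m,s) · C(m+u+v, v+s) · (m+u)! · (m+v)!. -/
open scoped Classical
open Finset

/-- Number of `X,Y`-descents of the word `w = w_1 ⋯ w_n` (indices `i` with
`w_i > w_{i+1}`, `w_i ∈ X`, `w_{i+1} ∈ Y`). -/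
noncomputable def desXY (X Y : Set ℕ) {n : ℕ} (w : Fin n → ℕ) : ℕ :=
  (Finset.univ.filter (fun i : Fin n =>
    ∃ h : i.1 + 1 < n, w i > w ⟨i.1 + 1, h⟩ ∧ w i ∈ X ∧ w ⟨i.1 + 1, h⟩ ∈ Y)).card

/-- `permCount X Y n s` is the number of permutations `σ` of `{1,…,n}` with
exactly `s` `X,Y`-descents. -/
noncomputable def permCount (X Y : Set ℕ) (n s : ℕ) : ℕ :=
  (Finset.univ.filter (fun σ : Equiv.Perm (Fin n) =>
    desXY X Y (fun i => (σ i : ℕ) + 1) = s)).card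

/-- `α_{S,n,j} = |{x : j < x ≤ n, x ∉ S}|`. -/
noncomputable def alphaSet (S : Set ℕ) (n j : ℕ) : ℕ :=
  ((Finset.Ioc j n).filter (fun x => x ∉ S)).card

/-- `β_{S,n,j} = |{x : 1 ≤ x < j, x ∉ S}|`. -/
noncomputable def betaSet (S : Set ℕ) (j : ℕ) : ℕ :=
  ((Finset.Ico 1 j).filter (fun x => x ∉ S)).card

noncomputable def exW (M : ℕ) {n : ℕ} (w : Fin n → ℕ) (i : ℕ) : ℕ :=
  if h : i < n then w ⟨i, h⟩ else M

def dd (X : Set ℕ) (f : ℕ → ℕ) (i : ℕ) : Prop := f (i + 1) < f i ∧ f i ∈ X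

lemma des_eq (X : Set ℕ) (M n : ℕ) (w : Fin n → ℕ) (hw : ∀ i, w i ≤ M) :
    desXY X Set.univ w = ((range n).filter (dd X (exW M w))).card := by
  unfold desXY
  refine Finset.card_bij (fun i _ => i.1) ?_ ?_ ?_
  · rintro ⟨i, hi⟩ h
    simp only [mem_filter, mem_univ, true_and, mem_range, dd, exW] at h ⊢
    obtain ⟨h1, h2, h3, _⟩ := h
    simp [hi, h1, h3]
    exact h2
  · intro a _ b _ h
    exact Fin.ext h
  · intro i h
    simp only [mem_filter, mem_range, dd, exW] at h
    obtain ⟨h1, h2, h3⟩ := h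
    refine ⟨⟨i, h1⟩, ?_, rfl⟩
    simp only [h1, dite_true] at h2 h3
    by_cases h4 : i + 1 < n
    · simp only [h4, dite_true] at h2
      simp only [mem_filter, mem_univ, true_and]
      exact ⟨h4, h2, h3, trivial⟩
    · simp only [h4, dite_false] at h2
      have := hw ⟨i, h1⟩
      omega

lemma ins_sum (X : Set ℕ) (N n p : ℕ) (f g : ℕ → ℕ) (hp : p ≤ n)
    (h1 : ∀ i < p, g i = f i) (h2 : g p = N) (h3 : ∀ i, p ≤ i → g (i + 1) = f i)
    (hf : ∀ i, f i ≤ N) :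
    ((range (n + 1)).filter (dd X g)).card + (if ∃ q, p = q + 1 ∧ dd X f q then 1 else 0)
      = ((range n).filter (dd X f)).card + (if f p < N ∧ N ∈ X then 1 else 0) := by
  rw [card_filter, card_filter]
  have hgp : dd X g p ↔ (f p < N ∧ N ∈ X) := by
    unfold dd; rw [h3 p le_rfl, h2]
  have hge : ∀ i, p ≤ i → (dd X g (i + 1) ↔ dd X f i) := by
    intro i hi
    unfold dd
    rw [h3 i hi, h3 (i + 1) (by omega)]
  obtain ⟨r, rfl⟩ := Nat.exists_eq_add_of_le hp
  have e2 : ∑ x ∈ range r, (if dd X g (p + 1 + x) then 1 else 0)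
      = ∑ x ∈ range r, (if dd X f (p + x) then 1 else 0) := by
    refine sum_congr rfl fun x _ => ?_
    have := hge (p + x) (by omega)
    rw [show p + 1 + x = p + x + 1 by omega]
    simp only [this]
  rw [show p + r + 1 = p + 1 + r by omega, sum_range_add _ (p + 1) r, sum_range_add _ p r, e2, sum_range_succ]
  simp only [hgp]
  rcases p with _ | q
  · simp
    omega
  · have e1 : ∑ x ∈ range q, (if dd X g x then 1 else 0)
      = ∑ x ∈ range q, (if dd X f x then 1 else 0) := by
      refine sum_congr rfl fun x hx => ?_
      have hx := mem_range.1 hx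
      have : dd X g x ↔ dd X f x := by
        unfold dd
        rw [h1 x (by omega), h1 (x + 1) (by omega)]
      simp only [this]
    have hq : ¬ dd X g q := by
      unfold dd
      rw [h2, h1 q (by omega)]
      have := hf q
      omega
    have hex : (∃ q', q + 1 = q' + 1 ∧ dd X f q') ↔ dd X f q := by
      constructor
      · rintro ⟨q', h, h'⟩
        obtain rfl : q = q' := by omega
        exact h'
      · intro h; exact ⟨q, rfl, h⟩
    rw [sum_range_succ, sum_range_succ, e1]
    simp only [hq, hex, if_false]
    omega

noncomputable def insP {n : ℕ} (x : Fin (n + 1) × Equiv.Perm (Fin n)) : Equiv.Perm (Fin (n + 1)) :=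
  ((finSuccEquiv' x.1).trans (Equiv.optionCongr x.2)).trans (finSuccEquiv' (Fin.last n)).symm

lemma insP_self {n : ℕ} (p : Fin (n + 1)) (σ : Equiv.Perm (Fin n)) :
    insP (p, σ) p = Fin.last n := by
  simp [insP]

lemma insP_succAbove {n : ℕ} (p : Fin (n + 1)) (σ : Equiv.Perm (Fin n)) (i : Fin n) :
    insP (p, σ) (p.succAbove i) = (σ i).castSucc := by
  simp [insP]

lemma insP_bij (n : ℕ) : Function.Bijective (insP (n := n)) := by
  rw [Fintype.bijective_iff_injective_and_card]
  constructor
  · rintro ⟨p, σ⟩ ⟨p', σ'⟩ h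
    have hp : p = p' := by
      have h1 := insP_self p σ
      rw [h, ← insP_self p' σ'] at h1
      exact (insP (p', σ')).injective h1
    subst hp
    have : σ = σ' := by
      ext i
      have h1 := insP_succAbove p σ i
      rw [h, insP_succAbove] at h1
      have := Fin.castSucc_injective _ h1
      rw [this]
    rw [this]
  · simp [Fintype.card_perm, Nat.factorial_succ]

noncomputable abbrev dP (X : Set ℕ) {n : ℕ} (σ : Equiv.Perm (Fin n)) : ℕ :=
  desXY X Set.univ (fun i => (σ i : ℕ) + 1)

noncomputable abbrev fP {n : ℕ} (σ : Equiv.Perm (Fin n)) : ℕ → ℕ :=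
  exW (n + 1) (fun i => (σ i : ℕ) + 1)

lemma dP_eq (X : Set ℕ) {n : ℕ} (σ : Equiv.Perm (Fin n)) :
    dP X σ = ((range n).filter (dd X (fP σ))).card :=
  des_eq X _ n _ (fun i => by have := (σ i).2; omega)

lemma dP_ins (X : Set ℕ) {n : ℕ} (σ : Equiv.Perm (Fin n)) (p : Fin (n + 1)) :
    dP X (insP (p, σ)) + (if ∃ q, (p : ℕ) = q + 1 ∧ dd X (fP σ) q then 1 else 0)
      = dP X σ + (if (p : ℕ) < n ∧ n + 1 ∈ X then 1 else 0) := by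
  rw [dP_eq X σ]
  have h0 : dP X (insP (p, σ)) = _ :=
    des_eq X (n + 1) (n + 1) _ (fun i => by have := (insP (p, σ) i).2; omega)
  rw [h0]
  have hp := p.2
  rw [ins_sum X (n + 1) n p (fP σ) _ (by omega)]
  · congr 1
    have : fP σ p < n + 1 ↔ (p : ℕ) < n := by
      unfold fP exW
      split_ifs with h
      · have := (σ ⟨p, h⟩).2
        simp
        omega
      · simp; omega
    simp only [this]
  · intro i hi
    have hin : i < n := by omega
    have e : (⟨i, by omega⟩ : Fin (n + 1)) = p.succAbove ⟨i, hin⟩ := by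
      rw [Fin.succAbove_of_castSucc_lt]
      · rfl
      · simpa [Fin.lt_def] using hi
    simp only [fP, exW, hin, dite_true, show i < n + 1 by omega]
    rw [e, insP_succAbove]
    rfl
  · simp only [exW, hp, dite_true]
    rw [show (⟨(p : ℕ), hp⟩ : Fin (n + 1)) = p from rfl, insP_self]
    simp
  · intro i hi
    by_cases hin : i < n
    · have e : (⟨i + 1, by omega⟩ : Fin (n + 1)) = p.succAbove ⟨i, hin⟩ := by
        rw [Fin.succAbove_of_le_castSucc]
        · rfl
        · simpa [Fin.le_def] using hi
      simp only [fP, exW, hin, dite_true, show i + 1 < n + 1 by omega]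
      rw [e, insP_succAbove]
      rfl
    · simp [fP, exW, hin]
  · intro i
    unfold fP exW
    split_ifs with h
    · have := (σ ⟨i, h⟩).2
      simp only []
      omega
    · exact le_rfl

noncomputable def BP (X : Set ℕ) {n : ℕ} (σ : Equiv.Perm (Fin n)) : Finset (Fin (n + 1)) :=
  univ.filter (fun p => ∃ q, (p : ℕ) = q + 1 ∧ dd X (fP σ) q)

lemma not_dd_last (X : Set ℕ) {n : ℕ} (σ : Equiv.Perm (Fin n)) (q : ℕ) (h : dd X (fP σ) q) :
    q + 1 < n := by
  by_contra hq
  have h1 : fP σ (q + 1) = n + 1 := by simp [fP, exW, hq]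
  have h2 : fP σ q ≤ n + 1 := by
    unfold fP exW
    split_ifs with h
    · have := (σ ⟨q, h⟩).2
      simp only []
      omega
    · exact le_rfl
  have := h.1
  omega

lemma BP_card (X : Set ℕ) {n : ℕ} (σ : Equiv.Perm (Fin n)) : (BP X σ).card = dP X σ := by
  rw [dP_eq]
  symm
  refine Finset.card_bij (fun q hq => ⟨q + 1, by have := mem_range.1 (mem_filter.1 hq).1; omega⟩)
    ?_ ?_ ?_
  · intro q hq
    exact mem_filter.2 ⟨mem_univ _, q, rfl, (mem_filter.1 hq).2⟩
  · intro a _ b _ h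
    simpa using h
  · intro p hp
    obtain ⟨q, h1, h2⟩ := (mem_filter.1 hp).2
    have := not_dd_last X σ q h2
    exact ⟨q, mem_filter.2 ⟨mem_range.2 (by omega), h2⟩, Fin.ext h1.symm⟩

lemma permCount_sum (X : Set ℕ) (n s : ℕ) :
    permCount X Set.univ (n + 1) s =
      ∑ σ : Equiv.Perm (Fin n), (univ.filter fun p : Fin (n + 1) => dP X (insP (p, σ)) = s).card := by
  unfold permCount
  rw [card_filter, ← (Equiv.ofBijective _ (insP_bij n)).sum_comp, Fintype.sum_prod_type_right]
  refine sum_congr rfl fun σ _ => ?_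
  rw [card_filter]
  rfl

lemma sum_ite_permCount (X : Set ℕ) (n s c : ℕ) :
    ∑ σ : Equiv.Perm (Fin n), (if dP X σ = s then c else 0) = c * permCount X Set.univ n s := by
  unfold permCount
  rw [← sum_filter, sum_const, smul_eq_mul, mul_comm]

lemma rec_notMem (X : Set ℕ) (n s : ℕ) (h : n + 1 ∉ X) :
    permCount X Set.univ (n + 1) s =
      (s + 1) * permCount X Set.univ n (s + 1) + (n + 1 - s) * permCount X Set.univ n s := by
  rw [permCount_sum, ← sum_ite_permCount, ← sum_ite_permCount, ← sum_add_distrib]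
  refine sum_congr rfl fun σ _ => ?_
  have key : ∀ p, dP X (insP (p, σ)) + (if p ∈ BP X σ then 1 else 0) = dP X σ := by
    intro p
    have := dP_ins X σ p
    simpa [h, BP] using this
  have hB := BP_card X σ
  by_cases h1 : dP X σ = s + 1
  · rw [if_pos h1, if_neg (by omega)]
    rw [add_zero, ← h1, ← hB]
    congr 1
    ext p
    have := key p
    simp only [mem_filter, mem_univ, true_and]
    split_ifs at this with hp <;> simp only [hp] <;> simp <;> omega
  · by_cases h2 : dP X σ = s
    · rw [if_neg h1, if_pos h2, zero_add]
      have : (BP X σ)ᶜ.card = n + 1 - s := by rw [card_compl, hB, h2, Fintype.card_fin]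
      rw [← this]
      congr 1
      ext p
      have := key p
      simp only [mem_filter, mem_univ, true_and, mem_compl]
      split_ifs at this with hp <;> simp only [hp] <;> simp <;> omega
    · rw [if_neg h1, if_neg h2, add_zero, card_eq_zero, filter_eq_empty_iff]
      intro p _ hh
      have := key p
      split_ifs at this <;> omega

lemma rec_mem (X : Set ℕ) (n s : ℕ) (h : n + 1 ∈ X) :
    permCount X Set.univ (n + 1) s =
      (s + 1) * permCount X Set.univ n s +
        (if s = 0 then 0 else (n + 1 - s) * permCount X Set.univ n (s - 1)) := by
  have hs : (if s = 0 then 0 else (n + 1 - s) * permCount X Set.univ n (s - 1))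
      = ∑ σ : Equiv.Perm (Fin n), (if dP X σ + 1 = s then (n + 1 - s) else 0) := by
    rcases s with _ | s
    · simp
    · rw [if_neg (by omega), ← sum_ite_permCount]
      simp
  rw [permCount_sum, hs, ← sum_ite_permCount, ← sum_add_distrib]
  refine sum_congr rfl fun σ _ => ?_
  have hlast : Fin.last n ∉ BP X σ := by
    intro hh
    obtain ⟨q, h1, h2⟩ := (mem_filter.1 hh).2
    have := not_dd_last X σ q h2
    simp at h1
    omega
  have key : ∀ p, dP X (insP (p, σ)) + (if p ∈ insert (Fin.last n) (BP X σ) then 1 else 0)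
      = dP X σ + 1 := by
    intro p
    have := dP_ins X σ p
    by_cases hp : p = Fin.last n
    · subst hp
      have h3 : ¬ ∃ q, ((Fin.last n : Fin (n+1)) : ℕ) = q + 1 ∧ dd X (fP σ) q := fun h3 =>
        hlast (mem_filter.2 ⟨mem_univ _, h3⟩)
      rw [if_neg h3, if_neg (by simp)] at this
      rw [if_pos (mem_insert_self _ _)]
      omega
    · have hp' : (p : ℕ) < n := by
        have := p.2
        have : (p : ℕ) ≠ n := fun h => hp (Fin.ext h)
        omega
      simpa [h, BP, hp, hp'] using this
  have hB : (insert (Fin.last n) (BP X σ)).card = dP X σ + 1 := by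
    rw [card_insert_of_notMem hlast, BP_card]
  generalize insert (Fin.last n) (BP X σ) = B at key hB
  by_cases h1 : dP X σ = s
  · rw [if_pos h1, if_neg (by omega), add_zero, ← h1, ← hB]
    congr 1
    ext p
    have := key p
    simp only [mem_filter, mem_univ, true_and]
    split_ifs at this with hp <;> simp only [hp] <;> simp <;> omega
  · by_cases h2 : dP X σ + 1 = s
    · rw [if_neg h1, if_pos h2, zero_add]
      have : Bᶜ.card = n + 1 - s := by rw [card_compl, hB, h2, Fintype.card_fin]
      rw [← this]
      congr 1
      ext p
      have := key p
      simp only [mem_filter, mem_univ, true_and, mem_compl]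
      split_ifs at this with hp <;> simp only [hp] <;> simp <;> omega
    · rw [if_neg h1, if_neg h2, add_zero, card_eq_zero, filter_eq_empty_iff]
      intro p _ hh
      have := key p
      split_ifs at this <;> omega

lemma permCount_congr (X Y : Set ℕ) (n s : ℕ) (h : ∀ x ≤ n, (x ∈ X ↔ x ∈ Y)) :
    permCount X Set.univ n s = permCount Y Set.univ n s := by
  unfold permCount desXY
  have : ∀ (σ : Equiv.Perm (Fin n)) (i : Fin n), ((σ i : ℕ) + 1 ∈ X ↔ (σ i : ℕ) + 1 ∈ Y) :=
    fun σ i => h _ (by have := (σ i).2; omega)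
  simp only [this]

lemma permCount_empty (n s : ℕ) :
    permCount ∅ Set.univ n s = if s = 0 then n.factorial else 0 := by
  unfold permCount desXY
  by_cases h : s = 0
  · simp [h, Fintype.card_perm]
  · simp [h, Ne.symm h]

/-- the closed form -/
def FF (m u v s : ℕ) : ℕ :=
  Nat.choose m s * Nat.choose (m + u + v) (v + s) * Nat.factorial (m + u) * Nat.factorial (m + v)

lemma FF_v (m u v s : ℕ) :
    FF m u (v + 1) s = (s + 1) * FF m u v (s + 1) + (2 * m + u + v + 1 - s) * FF m u v s := by
  unfold FF
  by_cases hs : s ≤ m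
  swap
  · rw [Nat.choose_eq_zero_of_lt (by omega), Nat.choose_eq_zero_of_lt (by omega : m < s + 1)]
    simp
  obtain ⟨r, rfl⟩ := Nat.exists_eq_add_of_le hs
  have a1 := Nat.choose_succ_right_eq (s + r) s
  have a2 := Nat.choose_succ_right_eq (s + r + u + v) (v + s)
  have a3 := Nat.choose_succ_succ (s + r + u + v) (v + s)
  rw [show s + r - s = r by omega] at a1
  rw [show s + r + u + v - (v + s) = r + u by omega] at a2
  rw [show s + r + u + (v + 1) = s + r + u + v + 1 by omega, show v + 1 + s = v + s + 1 by omega,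
    show v + (s + 1) = v + s + 1 by omega, show s + r + (v + 1) = s + r + v + 1 by omega,
    Nat.factorial_succ, show 2 * (s + r) + u + v + 1 - s = s + 2 * r + u + v + 1 by omega]
  simp only [Nat.succ_eq_add_one] at a3
  rw [a3]
  generalize (s + r + u + v).choose (v + s + 1) = A at *
  generalize (s + r + u + v).choose (v + s) = B at *
  generalize (s + r).choose (s + 1) = C at *
  generalize (s + r).choose s = E at *
  generalize (s + r + u).factorial = G
  generalize (s + r + v).factorial = H
  zify at *
  linear_combination (-(A : ℤ) * G * H) * a1 + (E : ℤ) * G * H * a2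

lemma FF_m (m u s : ℕ) :
    FF (m + 1) u 0 s = (s + 1) * FF m u 1 s +
      (if s = 0 then 0 else (2 * m + u + 2 - s) * FF m u 1 (s - 1)) := by
  unfold FF
  rcases s with _ | s
  · simp
    have := Nat.factorial_succ (m + u)
    rw [show m + 1 + u = m + u + 1 by omega, this]
    left
    ring
  rw [if_neg (by omega), show s + 1 - 1 = s by omega]
  by_cases hs : s ≤ m
  swap
  · rw [Nat.choose_eq_zero_of_lt (by omega : m + 1 < s + 1), Nat.choose_eq_zero_of_lt (by omega : m < s + 1), 
      Nat.choose_eq_zero_of_lt (by omega : m < s)]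
    simp
  obtain ⟨r, rfl⟩ := Nat.exists_eq_add_of_le hs
  have a1 := Nat.choose_succ_right_eq (s + r) s
  have a2 := Nat.choose_succ_right_eq (s + r + u + 1) (s + 1)
  have a3 := Nat.choose_succ_succ (s + r) s
  rw [show s + r - s = r by omega] at a1
  rw [show s + r + u + 1 - (s + 1) = r + u by omega] at a2
  rw [show s + r + 1 + u + 0 = s + r + u + 1 by omega, show 0 + (s + 1) = s + 1 by omega,
    show 1 + (s + 1) = s + 1 + 1 by omega, show 1 + s = s + 1 by omega,
    show s + r + 1 + u = s + r + u + 1 by omega, show s + r + 1 + 0 = s + r + 1 by omega,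
    Nat.factorial_succ (s + r + u),
    show 2 * (s + r) + u + 2 - (s + 1) = s + 2 * r + u + 1 by omega]
  simp only [Nat.succ_eq_add_one] at a3
  rw [a3]
  generalize (s + r + u + 1).choose (s + 1 + 1) = A at *
  generalize (s + r + u + 1).choose (s + 1) = B at *
  generalize (s + r).choose (s + 1) = C at *
  generalize (s + r).choose s = E at *
  generalize (s + r + u).factorial = G
  generalize (s + r + 1).factorial = H
  zify at *
  linear_combination (B * G * H) * a1 - (C : ℤ) * G * H * a2

def XX (u m : ℕ) : Set ℕ := {x : ℕ | ∃ i, 1 ≤ i ∧ i ≤ m ∧ x = u + 2 * i}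

lemma step_v (u m : ℕ) (h : ∀ s, permCount (XX u m) Set.univ (2 * m + u) s = FF m u 0 s) (v : ℕ) :
    ∀ s, permCount (XX u m) Set.univ (2 * m + u + v) s = FF m u v s := by
  induction v with
  | zero => exact h
  | succ v ih =>
    intro s
    rw [show 2 * m + u + (v + 1) = 2 * m + u + v + 1 by omega, rec_notMem, ih, ih, FF_v]
    rintro ⟨i, h1, h2, h3⟩
    omega

lemma step_m (u m : ℕ) : ∀ s, permCount (XX u m) Set.univ (2 * m + u) s = FF m u 0 s := by
  induction m with
  | zero =>
    intro s
    rw [permCount_congr _ ∅, permCount_empty]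
    · rcases s with _ | s <;> simp [FF]
    · intro x _
      simp only [Set.mem_empty_iff_false, iff_false]
      rintro ⟨i, h1, h2, h3⟩
      omega
  | succ m ih =>
    intro s
    have h1 := step_v u m ih 1
    have h2 : ∀ s, permCount (XX u (m + 1)) Set.univ (2 * m + u + 1) s = FF m u 1 s := by
      intro s
      rw [← h1]
      apply permCount_congr
      intro x hx
      constructor
      · rintro ⟨i, a, b, c⟩
        exact ⟨i, a, by omega, c⟩
      · rintro ⟨i, a, b, c⟩
        exact ⟨i, a, by omega, c⟩
    rw [show 2 * (m + 1) + u = 2 * m + u + 1 + 1 by omega, rec_mem, h2, h2, FF_m]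
    exact ⟨m + 1, by omega, le_rfl, by omega⟩

theorem stmt8 (u v m s : ℕ) (hm : 1 ≤ m) :
    permCount {x : ℕ | ∃ i, 1 ≤ i ∧ i ≤ m ∧ x = u + 2 * i} Set.univ (2 * m + u + v) s =
      Nat.choose m s * Nat.choose (m + u + v) (v + s) *
        Nat.factorial (m + u) * Nat.factorial (m + v) :=
  step_v u m (step_m u m) v s
end

section
/- Let k, n ≥ 1, let ρ = (k, k, …, k) with 2n parts (a composition of 2kn), and let X = 2ℕ be the set of positive even integers. Then for all s ≥ 0, the number P_{ρ,s}^{X} of rearrangements of the word 1^k 2^k ⋯ (2n)^k with exactly s descents whose top is even equals ((kn)!/(k!)^n)² · C(kn, s)². -/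
open scoped Classical
open Finset

/-- `wordCount X Y n m ρ s` is the number of words `w` of length `n` over the
alphabet `{1,…,m}` with exactly `ρ j` occurrences of each letter `j ∈ {1,…,m}`
(i.e. words in the rearrangement class `R(ρ)` of `1^{ρ_1} ⋯ m^{ρ_m}`) having
exactly `s` `X,Y`-descents. -/
noncomputable def wordCount (X Y : Set ℕ) (n m : ℕ) (ρ : ℕ → ℕ) (s : ℕ) : ℕ :=
  Set.ncard {w : Fin n → ℕ |
    (∀ i, 1 ≤ w i ∧ w i ≤ m) ∧
    (∀ j, 1 ≤ j → j ≤ m → (Finset.univ.filter (fun i => w i = j)).card = ρ j) ∧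
    desXY X Y w = s}


/-- Number of descents with even top, recursively on lists. -/
def desL : List ℕ → ℕ
  | [] => 0
  | [_] => 0
  | a :: b :: l => (if 2 ∣ a ∧ b < a then 1 else 0) + desL (b :: l)

/-- All rearrangements of a multiset. -/
noncomputable def LS (M : Multiset ℕ) : Finset (List ℕ) := M.lists.toFinset

lemma mem_LS (M : Multiset ℕ) (w : List ℕ) : w ∈ LS M ↔ (w : Multiset ℕ) = M := by
  unfold LS
  rw [Multiset.mem_toFinset, Multiset.mem_lists_iff]
  exact eq_comm

/-- Number of even letters bigger than `m`. -/
def evL (m : ℕ) (w : List ℕ) : ℕ := w.countP (fun a => decide (2 ∣ a ∧ m < a))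

lemma desL_cons_min (m : ℕ) (l : List ℕ) (h : ∀ x ∈ l, m ≤ x) : desL (m :: l) = desL l := by
  cases l with
  | nil => rfl
  | cons b l =>
    have := h b (by simp)
    have h2 : ¬ (2 ∣ m ∧ b < m) := by omega
    simp [desL, h2]

lemma sum_ins_aux (m : ℕ) (l : List ℕ) : ∀ (a : ℕ) (g : ℕ → ℤ), (∀ x ∈ a :: l, m ≤ x) →
    ∑ i ∈ range (l.length + 1), g (desL (a :: l.insertIdx i m)) =
      ((evL m (a :: l) : ℤ) - desL (a :: l)) * g (desL (a :: l) + 1) +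
      ((l.length : ℤ) + 1 - evL m (a :: l) + desL (a :: l)) * g (desL (a :: l)) := by
  induction l with
  | nil =>
    intro a g h
    by_cases h1 : 2 ∣ a ∧ m < a
    · simp [desL, evL, h1]
    · simp only [desL, evL, h1]
      simp [h1]
      simp [desL, h1]
  | cons b l ih =>
    intro a g h
    have hb : ∀ x ∈ b :: l, m ≤ x := fun x hx => h x (List.mem_cons_of_mem _ hx)
    rw [List.length_cons, Finset.sum_range_succ']
    have e1 : ∀ i, desL (a :: (b :: l).insertIdx (i + 1) m) =
        (if 2 ∣ a ∧ b < a then 1 else 0) + desL (b :: l.insertIdx i m) := by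
      intro i; simp [desL]
    have e0 : desL (a :: (b :: l).insertIdx 0 m) =
        (if 2 ∣ a ∧ m < a then 1 else 0) + desL (b :: l) := by
      rw [List.insertIdx_zero, desL, desL_cons_min m _ hb]
    simp only [e1, e0]
    rw [ih b (fun t => g ((if 2 ∣ a ∧ b < a then 1 else 0) + t)) hb]
    have e2 : evL m (a :: b :: l) = evL m (b :: l) + (if 2 ∣ a ∧ m < a then 1 else 0) := by
      unfold evL
      rw [List.countP_cons]
      simp
    have hmb : m ≤ b := hb b (by simp)
    rw [e2]
    simp only [desL]
    generalize desL (b :: l) = d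
    generalize evL m (b :: l) = e
    by_cases h1 : 2 ∣ a ∧ m < a
    · by_cases h2 : 2 ∣ a ∧ b < a
      · simp only [h1, h2, if_true, and_self]
        push_cast
        rw [show 1 + (d + 1) = 1 + d + 1 by ring]
        ring
      · simp only [if_pos h1, if_neg h2]
        push_cast
        rw [show 1 + d = d + 1 by ring, show 0 + (d + 1) = d + 1 by ring,
          show 0 + d + 1 = d + 1 by ring]
        ring
    · have h2 : ¬ (2 ∣ a ∧ b < a) := by omega
      simp only [h1, h2, if_false]
      push_cast
      rw [show 0 + (d + 1) = 0 + d + 1 by ring]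
      ring

lemma sum_ins (m : ℕ) (l : List ℕ) (g : ℕ → ℤ) (h : ∀ x ∈ l, m ≤ x) :
    ∑ i ∈ range (l.length + 1), g (desL (l.insertIdx i m)) =
      ((evL m l : ℤ) - desL l) * g (desL l + 1) +
      ((l.length : ℤ) + 1 - evL m l + desL l) * g (desL l) := by
  cases l with
  | nil => simp [desL, evL]
  | cons a l =>
    rw [List.length_cons, Finset.sum_range_succ', List.insertIdx_zero, desL_cons_min m _ h]
    simp only [List.insertIdx_succ_cons]
    rw [sum_ins_aux m l a g h]
    push_cast
    ring

lemma count_eq_sum (m : ℕ) (w : List ℕ) :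
    w.count m = ((range w.length).filter (fun i => w[i]? = some m)).card := by
  induction w with
  | nil => simp
  | cons a l ih =>
    rw [List.count_cons, ih, Finset.card_filter, Finset.card_filter, List.length_cons,
      Finset.sum_range_succ']
    simp

lemma ins_erase (m : ℕ) (w : List ℕ) (i : ℕ) (h2 : i < w.length) (h3 : w[i]? = some m) :
    (w.eraseIdx i).insertIdx i m = w := by
  have h : w[i] = m := by
    rw [List.getElem?_eq_getElem h2] at h3
    exact Option.some.inj h3
  rw [← h]
  exact List.insertIdx_eraseIdx_getElem h2

lemma double_count (m : ℕ) (M : Multiset ℕ) (h : List ℕ → ℤ) :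
    ∑ w ∈ LS (m ::ₘ M), (w.count m : ℤ) * h w =
      ∑ w ∈ LS M, ∑ i ∈ range (w.length + 1), h (w.insertIdx i m) := by
  have e : ∀ w : List ℕ, (w.count m : ℤ) * h w =
      ∑ i ∈ (range w.length).filter (fun i => w[i]? = some m), h w := by
    intro w
    rw [Finset.sum_const, ← count_eq_sum]; simp
  simp only [e]
  rw [Finset.sum_sigma', Finset.sum_sigma']
  refine Finset.sum_bij' (fun p _ => ⟨p.1.eraseIdx p.2, p.2⟩) (fun p _ => ⟨p.1.insertIdx p.2 m, p.2⟩)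
    ?_ ?_ ?_ ?_ ?_
  · rintro ⟨w, i⟩ hp
    simp only [Finset.mem_sigma, mem_LS, Finset.mem_filter, Finset.mem_range] at hp ⊢
    obtain ⟨h1, h2, h3⟩ := hp
    have h4 := ins_erase m w i h2 h3
    have h5 : i ≤ (w.eraseIdx i).length := by
      rw [List.length_eraseIdx_of_lt h2]; omega
    refine ⟨?_, by omega⟩
    have h6 := List.perm_insertIdx m (w.eraseIdx i) h5
    rw [h4] at h6
    have h7 := Multiset.coe_eq_coe.mpr h6
    rw [h1, ← Multiset.cons_coe] at h7
    exact ((Multiset.cons_inj_right m).mp h7).symm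
  · rintro ⟨w, i⟩ hp
    simp only [Finset.mem_sigma, mem_LS, Finset.mem_filter, Finset.mem_range] at hp ⊢
    obtain ⟨h1, h2⟩ := hp
    have h6 := Multiset.coe_eq_coe.mpr (List.perm_insertIdx m w (by omega : i ≤ w.length))
    rw [← Multiset.cons_coe, h1] at h6
    refine ⟨h6, ?_, ?_⟩
    · rw [List.length_insertIdx]; split_ifs <;> omega
    · have hl : i < (w.insertIdx i m).length := by
        rw [List.length_insertIdx]; split_ifs <;> omega
      rw [List.getElem?_eq_getElem hl, List.getElem_insertIdx_self]
  · rintro ⟨w, i⟩ hp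
    simp only [Finset.mem_sigma, mem_LS, Finset.mem_filter, Finset.mem_range] at hp ⊢
    obtain ⟨h1, h2, h3⟩ := hp
    rw [ins_erase m w i h2 h3]
  · rintro ⟨w, i⟩ hp
    simp [List.eraseIdx_insertIdx_self]
  · rintro ⟨w, i⟩ hp
    simp only [Finset.mem_sigma, mem_LS, Finset.mem_filter, Finset.mem_range] at hp ⊢
    obtain ⟨h1, h2, h3⟩ := hp
    rw [ins_erase m w i h2 h3]

/-- Number of rearrangements of `M` with `s` even descents. -/
noncomputable def T (M : Multiset ℕ) (s : ℕ) : ℤ := ∑ w ∈ LS M, if desL w = s then 1 else 0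

lemma T_rec (m : ℕ) (M : Multiset ℕ) (hM : ∀ x ∈ M, m ≤ x) (e : ℕ)
    (he : M.countP (fun a => 2 ∣ a ∧ m < a) = e) (s : ℕ) :
    ((M.count m : ℤ) + 1) * T (m ::ₘ M) s =
      ((e : ℤ) - s + 1) * (if s = 0 then 0 else T M (s - 1)) +
        ((M.card : ℤ) + 1 - e + s) * T M s := by
  have key := double_count m M (fun w => if desL w = s then 1 else 0)
  have l1 : ∑ w ∈ LS (m ::ₘ M), (w.count m : ℤ) * (if desL w = s then 1 else 0) =
      ((M.count m : ℤ) + 1) * T (m ::ₘ M) s := by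
    unfold T
    rw [Finset.mul_sum]
    refine Finset.sum_congr rfl fun w hw => ?_
    rw [mem_LS] at hw
    rw [← Multiset.coe_count, hw, Multiset.count_cons_self]
    push_cast; rfl
  rw [← l1, key]
  have l2 : (if s = 0 then 0 else T M (s - 1)) =
      ∑ w ∈ LS M, if desL w + 1 = s then (1 : ℤ) else 0 := by
    cases s with
    | zero => simp
    | succ s => simp [T]
  rw [l2, T, Finset.mul_sum, Finset.mul_sum, ← Finset.sum_add_distrib]
  refine Finset.sum_congr rfl fun w hw => ?_
  rw [mem_LS] at hw
  rw [sum_ins m w (fun t => if t = s then 1 else 0)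
    (fun x hx => hM x (by rw [← hw]; exact Multiset.mem_coe.mpr hx))]
  have h1 : evL m w = e := by
    rw [← he, ← hw, Multiset.coe_countP]; rfl
  have h2 : w.length = M.card := by rw [← hw]; rfl
  rw [h1, h2]
  congr 1
  · by_cases h : desL w + 1 = s
    · rw [if_pos h, ← h]; push_cast; ring
    · simp [h]
  · by_cases h : desL w = s
    · rw [if_pos h, ← h]
    · simp [h]

/-- Binomial step. -/
lemma binom_step (N P s : ℕ) :
    ((P : ℤ) - s + 1) * (if s = 0 then 0 else (N.choose (s - 1) * P.choose (s - 1) : ℤ)) +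
      ((N : ℤ) + 1 + s) * (N.choose s * P.choose s) =
      ((N : ℤ) + 1) * ((N + 1).choose s * P.choose s) := by
  cases s with
  | zero => simp
  | succ s =>
    have h1 : ((P.choose (s + 1) : ℤ)) * (s + 1) = P.choose s * ((P : ℤ) - s) := by
      rcases le_or_gt s P with h | h
      · have := Nat.choose_succ_right_eq P s
        zify [h] at this
        exact this
      · simp [Nat.choose_eq_zero_of_lt h, Nat.choose_eq_zero_of_lt (Nat.lt_succ_of_lt h)]
    have h2 : ((N.choose (s + 1) : ℤ)) * (s + 1) = N.choose s * ((N : ℤ) - s) := by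
      rcases le_or_gt s N with h | h
      · have := Nat.choose_succ_right_eq N s
        zify [h] at this
        exact this
      · simp [Nat.choose_eq_zero_of_lt h, Nat.choose_eq_zero_of_lt (Nat.lt_succ_of_lt h)]
    rw [Nat.choose_succ_succ]
    simp only [Nat.add_sub_cancel, Nat.succ_ne_zero, if_false]
    push_cast
    linear_combination (-(N.choose s : ℤ)) * h1 + (P.choose (s + 1) : ℤ) * h2

/-- Insert `j` copies of a new smallest letter. -/
lemma T_block (m : ℕ) (M : Multiset ℕ) (hM : ∀ x ∈ M, m < x) (N P : ℕ) (K : ℤ)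
    (he : M.countP (fun a => 2 ∣ a) = P) (hc : M.card = P + N)
    (hT : ∀ s, T M s = K * (N.choose s * P.choose s)) (j : ℕ) :
    ∀ s, T (M + Multiset.replicate j m) s =
      K * (N + j).choose j * ((N + j).choose s * P.choose s) := by
  induction j with
  | zero => intro s; simp [hT]
  | succ j ih =>
    intro s
    have hcount : (M + Multiset.replicate j m).count m = j := by
      rw [Multiset.count_add, Multiset.count_replicate_self, Multiset.count_eq_zero.mpr, zero_add]
      intro h; exact lt_irrefl _ (hM m h)
    have r := T_rec m (M + Multiset.replicate j m) (by
      intro x hx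
      rcases Multiset.mem_add.mp hx with hx | hx
      · exact (hM x hx).le
      · rw [Multiset.eq_of_mem_replicate hx]) P (by
      rw [Multiset.countP_add, Multiset.countP_congr rfl (p' := fun a => 2 ∣ a)
        (fun x hx => by simp [hM x hx]), he, Multiset.countP_eq_zero.mpr]
      · rfl
      · intro x hx
        rw [Multiset.eq_of_mem_replicate hx]; omega) s
    rw [hcount] at r
    have e : m ::ₘ (M + Multiset.replicate j m) = M + Multiset.replicate (j + 1) m := by
      rw [Multiset.replicate_succ, Multiset.add_cons]
    rw [e, Multiset.card_add, Multiset.card_replicate, hc, ih s, ih (s - 1)] at r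
    have b := binom_step (N + j) P s
    have c : ((N : ℤ) + j + 1) * (N + j).choose j = (N + j + 1).choose (j + 1) * (j + 1) := by
      exact_mod_cast Nat.add_one_mul_choose_eq (N + j) j
    have hj : ((j : ℤ) + 1) ≠ 0 := by positivity
    apply mul_left_cancel₀ hj
    rw [r, ← add_assoc N j 1]
    push_cast at b ⊢
    split_ifs at b ⊢ with h0
    · linear_combination K * (N + j).choose j * b +
        K * ((N + j + 1).choose s * P.choose s) * c
    · linear_combination K * (N + j).choose j * b +
        K * ((N + j + 1).choose s * P.choose s) * c

/-- `k` copies of each letter `2q+1, …, 2(q+p)`. -/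
def MM (k : ℕ) : ℕ → ℕ → Multiset ℕ
  | 0, _ => 0
  | p + 1, q => MM k p (q + 1) + Multiset.replicate k (2 * q + 2) + Multiset.replicate k (2 * q + 1)

lemma MM_count (k p : ℕ) : ∀ q j, (MM k p q).count j =
    if 2 * q + 1 ≤ j ∧ j ≤ 2 * (q + p) then k else 0 := by
  induction p with
  | zero => intro q j; rw [if_neg (by omega)]; simp [MM]
  | succ p ih =>
    intro q j
    rw [MM, Multiset.count_add, Multiset.count_add, ih, Multiset.count_replicate,
      Multiset.count_replicate]
    split_ifs <;> omega

lemma MM_mem (k p q x : ℕ) (h : x ∈ MM k p q) : 2 * q + 1 ≤ x := by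
  by_contra h2
  have := MM_count k p q x
  rw [if_neg (by omega)] at this
  exact (Multiset.count_eq_zero.mp this) h

lemma MM_card (k p : ℕ) : ∀ q, (MM k p q).card = k * p + k * p := by
  induction p with
  | zero => intro q; simp [MM]
  | succ p ih => intro q; simp [MM, ih]; ring

lemma MM_ev (k p : ℕ) : ∀ q, (MM k p q).countP (fun a => 2 ∣ a) = k * p := by
  induction p with
  | zero => intro q; simp [MM]
  | succ p ih =>
    intro q
    rw [MM, Multiset.countP_add, Multiset.countP_add, ih]
    rw [Multiset.countP_eq_card.mpr, Multiset.countP_eq_zero.mpr, Multiset.card_replicate]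
    · ring
    · intro x hx; rw [Multiset.eq_of_mem_replicate hx]; omega
    · intro x hx; rw [Multiset.eq_of_mem_replicate hx]; omega

/-- The square root of the prefactor. -/
def KK (k : ℕ) : ℕ → ℕ
  | 0 => 1
  | p + 1 => KK k p * (k * p + k).choose k

lemma KK_eq (k p : ℕ) : KK k p * (k.factorial) ^ p = (k * p).factorial := by
  induction p with
  | zero => simp [KK]
  | succ p ih =>
    have := Nat.add_choose_mul_factorial_mul_factorial (k * p) k
    rw [← ih] at this
    rw [KK, mul_add, mul_one, ← this]
    ring

lemma T_MM (k p : ℕ) : ∀ q s, T (MM k p q) s = (KK k p : ℤ) ^ 2 * ((k * p).choose s) ^ 2 := by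
  induction p with
  | zero =>
    intro q s
    have : LS 0 = {[]} := by
      ext w; rw [mem_LS]; simp
    rw [MM, T, this]
    rw [Finset.sum_singleton]
    cases s <;> simp [desL, KK]
  | succ p ih =>
    intro q s
    have h1 := T_block (2 * q + 2) (MM k p (q + 1)) (fun x hx => by
      have := MM_mem _ _ _ _ hx; omega) (k * p) (k * p) ((KK k p : ℤ) ^ 2) (MM_ev k p _)
      (MM_card k p _) (fun s => by rw [ih]; ring) k
    have h2 := T_block (2 * q + 1) (MM k p (q + 1) + Multiset.replicate k (2 * q + 2))
      (fun x hx => by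
        rcases Multiset.mem_add.mp hx with hx | hx
        · have := MM_mem _ _ _ _ hx; omega
        · rw [Multiset.eq_of_mem_replicate hx]; omega) (k * p) (k * p + k)
      ((KK k p : ℤ) ^ 2 * (k * p + k).choose k) (by
        rw [Multiset.countP_add, MM_ev, Multiset.countP_eq_card.mpr, Multiset.card_replicate]
        intro x hx; rw [Multiset.eq_of_mem_replicate hx]; omega)
      (by rw [Multiset.card_add, MM_card, Multiset.card_replicate]; ring)
      (fun s => by rw [h1]; ring) k s
    rw [MM, h2, KK, mul_add, mul_one]
    push_cast
    ring

lemma desXY_ofFn (L : ℕ) : ∀ w : Fin L → ℕ, (∀ i, 1 ≤ w i) →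
    desXY {x : ℕ | 0 < x ∧ 2 ∣ x} Set.univ w = desL (List.ofFn w) := by
  induction L with
  | zero => intro w _; simp [desXY, desL]
  | succ L ih =>
    intro w hw
    have h0 := ih (fun i => w i.succ) (fun i => hw _)
    unfold desXY at h0 ⊢
    rw [Finset.card_filter] at h0 ⊢
    rw [Fin.sum_univ_succ, List.ofFn_succ]
    cases L with
    | zero =>
      rw [if_neg (by rintro ⟨h, -⟩; exact absurd h (by simp)), Finset.univ_eq_empty,
        Finset.sum_empty, List.ofFn_zero, desL, add_zero]
    | succ L =>
      rw [List.ofFn_succ] at h0 ⊢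
      rw [desL, ← h0]
      congr 1
      · have := hw 0
        have e : (⟨(0 : Fin (L + 1 + 1)).1 + 1, by simp⟩ : Fin (L + 1 + 1)) = Fin.succ 0 := rfl
        have : (∃ h : (0 : Fin (L + 1 + 1)).1 + 1 < L + 1 + 1,
          w 0 > w ⟨(0 : Fin (L + 1 + 1)).1 + 1, h⟩ ∧ w 0 ∈ {x : ℕ | 0 < x ∧ 2 ∣ x} ∧
            w ⟨(0 : Fin (L + 1 + 1)).1 + 1, h⟩ ∈ Set.univ) ↔ (2 ∣ w 0 ∧ w (Fin.succ 0) < w 0) := by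
          constructor
          · rintro ⟨h, h1, h2, -⟩
            exact ⟨h2.2, h1⟩
          · rintro ⟨h1, h2⟩
            exact ⟨by simp, h2, ⟨hw 0, h1⟩, trivial⟩
        simp only [this]
      · refine Finset.sum_congr rfl fun i _ => ?_
        split_ifs with h1 h2 h2
        · rfl
        · obtain ⟨h, h1⟩ := h1
          exact absurd ⟨by simpa using h, h1⟩ h2
        · obtain ⟨h, h2⟩ := h2
          exact absurd ⟨by simpa using h, h2⟩ h1
        · rfl

lemma count_ofFn' (j L : ℕ) : ∀ w : Fin L → ℕ,
    (Finset.univ.filter (fun i => w i = j)).card = (List.ofFn w).count j := by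
  induction L with
  | zero => intro w; simp
  | succ L ih =>
    intro w
    have h0 := ih (fun i => w i.succ)
    rw [Finset.card_filter] at h0 ⊢
    rw [Fin.sum_univ_succ, List.ofFn_succ, List.count_cons, ← h0, add_comm]
    simp

theorem stmt18 (k n s : ℕ) (hk : 1 ≤ k) (hn : 1 ≤ n) :
    wordCount {x : ℕ | 0 < x ∧ 2 ∣ x} Set.univ (2 * k * n) (2 * n) (fun _ => k) s =
      (Nat.factorial (k * n) / (Nat.factorial k) ^ n) ^ 2 * (Nat.choose (k * n) s) ^ 2 := by
  have hK : Nat.factorial (k * n) / (Nat.factorial k) ^ n = KK k n := by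
    rw [← KK_eq]
    exact Nat.mul_div_cancel _ (pow_pos (Nat.factorial_pos k) n)
  rw [hK]
  have hT := T_MM k n 0 s
  rw [T, Finset.sum_boole] at hT
  have hT' : ((LS (MM k n 0)).filter (fun w => desL w = s)).card =
      (KK k n) ^ 2 * ((k * n).choose s) ^ 2 := by exact_mod_cast hT
  rw [← hT', wordCount, ← Set.ncard_coe_finset,
    ← Set.ncard_image_of_injective _ (List.ofFn_injective (n := 2 * k * n))]
  congr 1
  ext l
  simp only [Set.mem_image, Set.mem_ofPred_eq, Finset.coe_filter, mem_LS]
  constructor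
  · rintro ⟨w, ⟨h1, h2, h3⟩, rfl⟩
    refine ⟨?_, ?_⟩
    · ext j
      rw [Multiset.coe_count, MM_count, ← count_ofFn']
      split_ifs with h
      · exact h2 j (by omega) (by omega)
      · rw [Finset.card_eq_zero, Finset.filter_eq_empty_iff]
        intro i _ hi
        have := h1 i
        omega
    · rw [← desXY_ofFn _ w (fun i => (h1 i).1)]; exact h3
  · rintro ⟨h1, h2⟩
    have hlen : l.length = 2 * k * n := by
      have := congrArg Multiset.card h1
      rw [MM_card, Multiset.coe_card] at this
      rw [this]; ring
    subst_vars
    obtain ⟨w, rfl⟩ : ∃ w : Fin (2 * k * n) → ℕ, List.ofFn w = l := by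
      rw [← hlen]
      exact ⟨l.get, List.ofFn_get l⟩
    have hc : ∀ j, (Finset.univ.filter (fun i => w i = j)).card =
        if 2 * 0 + 1 ≤ j ∧ j ≤ 2 * (0 + n) then k else 0 := by
      intro j
      rw [count_ofFn', ← Multiset.coe_count, h1, MM_count]
    have hb : ∀ i, 1 ≤ w i ∧ w i ≤ 2 * n := by
      intro i
      by_contra hcon
      have := hc (w i)
      rw [if_neg (by omega), Finset.card_eq_zero, Finset.filter_eq_empty_iff] at this
      exact this (Finset.mem_univ i) rfl
    refine ⟨w, ⟨hb, ?_, ?_⟩, rfl⟩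
    · intro j hj1 hj2
      rw [hc, if_pos (by omega)]
    · exact desXY_ofFn _ w (fun i => (hb i).1)
end

section
/- Let k, n ≥ 1, let ρ = (k, k, …, k) with 2n parts, and let X = 2ℕ be the set of positive even integers. Then for all s ≥ 0, (k!)^{2n} · P_{ρ,s}^{X} = P_{2kn,s}^{X}; that is, (k!)^{2n} times the number of rearrangements of the word 1^k 2^k ⋯ (2n)^k with exactly s descents whose top is even equals the number of permutations of {1,…,2kn} with exactly s descents whose top is even. -/
open scoped Classical
open Finset

/-- descents with even top of the word `p :: l`. -/
def evDes : ℕ → List ℕ → ℕ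
  | _, [] => 0
  | p, y :: ys => (if y < p ∧ 2 ∣ p then 1 else 0) + evDes y ys

lemma insertion_sum (x : ℕ) (hx : 2 ∣ x) (l : List ℕ) : ∀ (p : ℕ) (φ : ℕ → ℤ),
    (2 ∣ p → p ≤ x) → (∀ y ∈ l, 2 ∣ y → y ≤ x) →
    ((List.permutations'Aux x l).map (fun l' => φ (evDes p l'))).sum =
      ((l.countP (fun y => decide (y < x)) : ℤ) - evDes p l) * φ (evDes p l + 1) +
      ((l.length : ℤ) + 1 - l.countP (fun y => decide (y < x)) + evDes p l) * φ (evDes p l) := by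
  induction l with
  | nil =>
    intro p φ hp _
    have : ¬ (x < p ∧ 2 ∣ p) := by rintro ⟨h1, h2⟩; have := hp h2; omega
    simp [List.permutations'Aux, evDes, this]
  | cons y ys ih =>
    intro p φ hp hl
    have hxp : ¬ (x < p ∧ 2 ∣ p) := by rintro ⟨h1, h2⟩; have := hp h2; omega
    have hy : 2 ∣ y → y ≤ x := hl y (by simp)
    have hys : ∀ z ∈ ys, 2 ∣ z → z ≤ x := fun z hz => hl z (by simp [hz])
    have key := ih y (fun d => φ ((if y < p ∧ 2 ∣ p then 1 else 0) + d)) hy hys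
    simp only [List.permutations'Aux, List.map_cons, List.sum_cons, List.map_map,
      Function.comp_def, evDes, if_neg hxp, List.length_cons, List.countP_cons]
    rw [key]
    by_cases hyp : y < p ∧ 2 ∣ p
    · have h1 : y < x := lt_of_lt_of_le hyp.1 (hp hyp.2)
      simp only [hyp, h1, hx, and_self, if_true, decide_true]
      push_cast
      ring_nf
    · by_cases h1 : y < x
      · simp only [hyp, h1, hx, and_self, if_true, if_false, decide_true]
        push_cast
        ring_nf
      · simp only [hyp, h1, hx, if_false, decide_false, false_and]
        push_cast
        simp
        ring_nf

/-- the kernel `C(N+r-d, N)`. -/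
def ker (N r d : ℕ) : ℤ := if d ≤ r then ((N + (r - d)).choose N : ℤ) else 0

lemma ker_rec (N r d : ℕ) (b : ℤ) :
    (b - d) * ker (N + 1) r (d + 1) + ((N : ℤ) + 1 - b + d) * ker (N + 1) r d =
      ((r : ℤ) + (N + 1) - b) * ker N r d := by
  unfold ker
  by_cases h : d ≤ r
  · obtain ⟨m, rfl⟩ := Nat.exists_eq_add_of_le h
    rcases m with _ | m
    · simp
      ring
    · have e1 : d + (m + 1) - (d + 1) = m := by omega
      have e2 : d + (m + 1) - d = m + 1 := by omega
      rw [if_pos (by omega), if_pos (by omega), if_pos (by omega), e1, e2]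
      have p1 : (N + 1 + (m + 1)).choose (N + 1) = (N + (m + 1)).choose N + (N + 1 + m).choose (N + 1) := by
        rw [show N + 1 + (m + 1) = (N + (m + 1)) + 1 by ring, Nat.choose_succ_succ]
        congr 2; ring
      have p2 : (N + 1 + m).choose (N + 1) * (N + 1) = (N + (m + 1)).choose N * (m + 1) := by
        have := Nat.choose_succ_right_eq (N + (m + 1)) N
        rw [show N + 1 + m = N + (m + 1) by ring, this]
        congr 1; omega
      have p2' : ((N + 1 + m).choose (N + 1) : ℤ) * (N + 1) = (N + (m + 1)).choose N * (m + 1) := by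
        exact_mod_cast p2
      rw [p1]
      push_cast
      linear_combination p2'
  · rw [if_neg (by omega), if_neg (by omega), if_neg (by omega)]
    simp

/-- weighted sum over all (labelled) rearrangements. -/
def wsum (L : List ℕ) (r : ℕ) : ℤ :=
  ((List.permutations' L).map (fun l => ker L.length r (evDes 0 l))).sum

lemma sum_map_flatMap {α β : Type*} (L : List α) (f : α → List β) (g : β → ℤ) :
    ((L.flatMap f).map g).sum = (L.map (fun a => ((f a).map g).sum)).sum := by
  induction L with
  | nil => simp
  | cons a L ih => simp [List.flatMap_cons, ih]

lemma wsum_cons (x : ℕ) (hx : 2 ∣ x) (L : List ℕ) (hL : ∀ y ∈ L, 2 ∣ y → y ≤ x) (r : ℕ) :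
    wsum (x :: L) r =
      ((r : ℤ) + (L.length + 1) - L.countP (fun y => decide (y < x))) * wsum L r := by
  unfold wsum
  rw [List.permutations', sum_map_flatMap, ← List.sum_map_mul_left]
  congr 1
  apply List.map_congr_left
  intro l hl
  have hp : l.Perm L := List.mem_permutations'.1 hl
  rw [List.length_cons]
  have := insertion_sum x hx l 0 (fun d => ker (L.length + 1) r d) (by simp)
    (fun y hy => hL y (hp.mem_iff.1 hy))
  rw [this, hp.length_eq, hp.countP_eq, ker_rec]

lemma evDes_odd (l : List ℕ) : ∀ p, (p = 0 ∨ ¬ 2 ∣ p) → (∀ y ∈ l, ¬ 2 ∣ y) → evDes p l = 0 := by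
  induction l with
  | nil => intros; rfl
  | cons y ys ih =>
    intro p hp h
    have h1 : ¬ (y < p ∧ 2 ∣ p) := by rintro ⟨h1, h2⟩; rcases hp with hp | hp <;> [omega; exact hp h2]
    simp only [evDes, if_neg h1]
    rw [ih y (Or.inr (h y (by simp))) (fun z hz => h z (by simp [hz]))]

lemma wsum_odd (L : List ℕ) (hL : ∀ y ∈ L, ¬ 2 ∣ y) (r : ℕ) :
    wsum L r = (L.length.factorial : ℤ) * ker L.length r 0 := by
  unfold wsum
  rw [List.map_congr_left (g := fun _ => ker L.length r 0)]
  · simp [(List.permutations_perm_permutations' L).length_eq.symm, List.length_permutations]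
  · intro l hl
    have hp : l.Perm L := List.mem_permutations'.1 hl
    rw [evDes_odd l 0 (Or.inl rfl) (fun y hy => hL y (hp.mem_iff.1 hy))]

def evl (k : ℕ) : ℕ → List ℕ
  | 0 => []
  | i + 1 => List.replicate k (2 * i + 2) ++ evl k i

def odl (k : ℕ) : ℕ → List ℕ
  | 0 => []
  | i + 1 => List.replicate k (2 * i + 1) ++ odl k i

lemma evl_length (k i : ℕ) : (evl k i).length = k * i := by
  induction i with
  | zero => rfl
  | succ i ih => simp [evl, ih]; ring

lemma odl_length (k i : ℕ) : (odl k i).length = k * i := by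
  induction i with
  | zero => rfl
  | succ i ih => simp [odl, ih]; ring

lemma mem_evl {k i y : ℕ} (h : y ∈ evl k i) : 2 ∣ y ∧ y ≤ 2 * i := by
  induction i with
  | zero => simp [evl] at h
  | succ i ih =>
    simp only [evl, List.mem_append, List.mem_replicate] at h
    rcases h with ⟨_, h⟩ | h
    · omega
    · have := ih h; omega

lemma mem_odl {k i y : ℕ} (h : y ∈ odl k i) : ¬ 2 ∣ y := by
  induction i with
  | zero => simp [odl] at h
  | succ i ih =>
    simp only [odl, List.mem_append, List.mem_replicate] at h
    rcases h with ⟨_, h⟩ | h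
    · omega
    · exact ih h

lemma odl_countP (k n i : ℕ) (h : i ≤ n) :
    (odl k n).countP (fun y => decide (y < 2 * i)) = k * i := by
  induction n with
  | zero => obtain rfl : i = 0 := by omega
            simp [odl]
  | succ n ih =>
    rcases Nat.lt_or_ge n i with h1 | h1
    · obtain rfl : i = n + 1 := by omega
      rw [← odl_length k (n + 1), List.countP_eq_length]
      intro y hy
      have : ∀ m, ∀ y ∈ odl k m, y < 2 * m := by
        intro m
        induction m with
        | zero => simp [odl]
        | succ m ihm =>
          intro y hy
          simp only [odl, List.mem_append, List.mem_replicate] at hy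
          rcases hy with ⟨_, h⟩ | h
          · omega
          · have := ihm y h; omega
      simpa using this _ y hy
    · rw [odl, List.countP_append, ih h1, List.countP_replicate]
      simp
      omega

lemma wsum_block (k n i : ℕ) (h : i < n) (r : ℕ) : ∀ c,
    wsum (List.replicate c (2 * i + 2) ++ (evl k i ++ odl k n)) r =
      (∏ j ∈ Finset.range c, ((r : ℤ) + (k * (n - 1 - i : ℕ) + j + 1))) *
        wsum (evl k i ++ odl k n) r := by
  intro c
  induction c with
  | zero => simp
  | succ c ih =>
    rw [List.replicate_succ, List.cons_append, wsum_cons _ (by omega), ih, Finset.prod_range_succ]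
    · have hb : (evl k i).countP (fun y => decide (y < 2 * i + 2)) = k * i := by
        rw [← evl_length k i, List.countP_eq_length]
        intro y hy
        have := mem_evl hy
        simp; omega
      have ho := odl_countP k n (i + 1) h
      rw [show 2 * (i + 1) = 2 * i + 2 by ring] at ho
      simp only [List.countP_append, List.length_append, List.length_replicate, evl_length,
        odl_length, List.countP_replicate, hb, ho]
      obtain ⟨m, rfl⟩ := Nat.exists_eq_add_of_lt h
      have : i + m + 1 - 1 - i = m := by omega
      rw [this]
      simp
      ring
    · intro y hy h2
      simp only [List.mem_append, List.mem_replicate] at hy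
      rcases hy with ⟨_, h⟩ | h | h
      · omega
      · have := mem_evl h; omega
      · exact absurd h2 (mem_odl h)

lemma wsum_blocks (k n r : ℕ) : ∀ i ≤ n,
    wsum (evl k i ++ odl k n) r =
      (∏ i' ∈ Finset.range i, ∏ j ∈ Finset.range k, ((r : ℤ) + (k * (n - 1 - i' : ℕ) + j + 1))) *
        wsum (odl k n) r := by
  intro i
  induction i with
  | zero => simp [evl]
  | succ i ih =>
    intro h
    rw [evl, List.append_assoc, wsum_block k n i (by omega) r k, ih (by omega),
      Finset.prod_range_succ]
    ring

lemma prod_blocks (k n r : ℕ) :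
    (∏ i ∈ Finset.range n, ∏ j ∈ Finset.range k, ((r : ℤ) + (k * (i : ℕ) + j + 1))) =
      ∏ j ∈ Finset.range (k * n), ((r : ℤ) + (j + 1)) := by
  induction n with
  | zero => simp
  | succ n ih =>
    rw [Finset.prod_range_succ, ih, Nat.mul_succ, Finset.prod_range_add]
    congr 1

lemma wsum_full (k n r : ℕ) :
    wsum (evl k n ++ odl k n) r =
      (∏ j ∈ Finset.range (k * n), ((r : ℤ) + (j + 1))) *
        (((k * n).factorial : ℤ) * ker (k * n) r 0) := by
  rw [wsum_blocks k n r n le_rfl, wsum_odd _ (fun y hy => mem_odl hy), odl_length, ← prod_blocks]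
  congr 1
  exact Finset.prod_range_reflect
    (fun i => ∏ j ∈ Finset.range k, ((r : ℤ) + (k * (i : ℕ) + j + 1))) n

lemma sum_ker (N r : ℕ) (A : List ℕ) :
    (A.map (fun d => ker N r d)).sum = ∑ s ∈ Finset.range (r + 1), (A.count s : ℤ) * ker N r s := by
  induction A with
  | nil => simp
  | cons a A ih =>
    rw [List.map_cons, List.sum_cons, ih]
    have : ∀ s, ((a :: A).count s : ℤ) * ker N r s =
        (if a = s then ker N r s else 0) + (A.count s : ℤ) * ker N r s := by
      intro s
      rw [List.count_cons]
      by_cases h : a = s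
      · simp [h]; ring
      · simp [h]
    simp only [this, Finset.sum_add_distrib, Finset.sum_ite_eq]
    congr 1
    by_cases h : a ≤ r
    · rw [if_pos (by simp; omega)]
    · rw [if_neg (by simp; omega), ker, if_neg h]

lemma count_eq_of_ker (N : ℕ) (A B : List ℕ)
    (h : ∀ r, (A.map (fun d => ker N r d)).sum = (B.map (fun d => ker N r d)).sum) (s : ℕ) :
    A.count s = B.count s := by
  induction s using Nat.strong_induction_on with
  | _ s ih =>
    have := h s
    rw [sum_ker, sum_ker, Finset.sum_range_succ, Finset.sum_range_succ,
      Finset.sum_congr rfl (fun t ht => by rw [ih t (Finset.mem_range.1 ht)])] at this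
    simpa [ker] using this

/-- Number of labelled rearrangements with `s` descents. -/
def lcount (L : List ℕ) (s : ℕ) : ℕ := ((List.permutations' L).map (evDes 0)).count s

lemma lcount_eq (k n s : ℕ) :
    lcount (evl k n ++ odl k n) s = lcount (evl 1 (k * n) ++ odl 1 (k * n)) s := by
  apply count_eq_of_ker (k * n + k * n)
  intro r
  have h1 := wsum_full k n r
  have h2 := wsum_full 1 (k * n) r
  simp only [wsum, List.length_append, evl_length, odl_length, one_mul] at h1 h2
  simp only [List.map_map, Function.comp_def]
  rw [h1, h2]

lemma lcount_perm {L L' : List ℕ} (h : L.Perm L') (s : ℕ) : lcount L s = lcount L' s :=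
  ((h.permutations').map _).count_eq _

lemma ite_congr_any {P Q : Prop} {i1 : Decidable P} {i2 : Decidable Q} (h : P ↔ Q) :
    (@ite ℕ P i1 1 0) = @ite ℕ Q i2 1 0 := by
  by_cases hq : Q
  · rw [if_pos (h.2 hq), if_pos hq]
  · rw [if_neg (fun hp => hq (h.1 hp)), if_neg hq]

lemma evDes_ofFn {N : ℕ} (w : Fin (N + 1) → ℕ) :
    desXY {x : ℕ | 0 < x ∧ 2 ∣ x} Set.univ w =
      evDes (w 0) (List.ofFn (fun i : Fin N => w i.succ)) := by
  induction N with
  | zero =>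
    have : ∀ i : Fin (0 + 1), ¬ (i.1 + 1 < 0 + 1) := by intro i; omega
    unfold desXY
    rw [List.ofFn_zero, evDes, Finset.card_eq_zero, Finset.filter_eq_empty_iff]
    rintro i _ ⟨h, _⟩
    exact this i h
  | succ N ih =>
    have ih' := ih (fun i => w i.succ)
    rw [List.ofFn_succ, evDes]
    refine Eq.trans ?_ (congrArg
      (fun t => (if w (Fin.succ 0) < w 0 ∧ 2 ∣ w 0 then 1 else 0) + t) ih')
    unfold desXY
    rw [Finset.card_filter, Finset.card_filter, Fin.sum_univ_succ]
    congr 1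
    · have : (∃ h : (0 : Fin (N + 2)).1 + 1 < N + 1 + 1, w 0 > w ⟨(0 : Fin (N + 2)).1 + 1, h⟩ ∧
          w 0 ∈ {x : ℕ | 0 < x ∧ 2 ∣ x} ∧ w ⟨(0 : Fin (N + 2)).1 + 1, h⟩ ∈ Set.univ) ↔
          (w (Fin.succ 0) < w 0 ∧ 2 ∣ w 0) := by
        have e : ∀ h, (⟨(0 : Fin (N + 2)).1 + 1, h⟩ : Fin (N + 2)) = Fin.succ 0 := fun h => rfl
        simp only [e, Set.mem_univ, Set.mem_ofPred_eq, and_true]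
        constructor
        · rintro ⟨_, h1, _, h2⟩; exact ⟨h1, h2⟩
        · rintro ⟨h1, h2⟩; exact ⟨by simp, h1, by omega, h2⟩
      exact ite_congr_any this
    · apply Finset.sum_congr rfl
      intro i _
      refine ite_congr_any ?_
      constructor
      · rintro ⟨h, hh⟩; exact ⟨by simpa using h, hh⟩
      · rintro ⟨h, hh⟩; exact ⟨by simpa using h, hh⟩

lemma desXY_eq {N : ℕ} (w : Fin N → ℕ) :
    desXY {x : ℕ | 0 < x ∧ 2 ∣ x} Set.univ w = evDes 0 (List.ofFn w) := by
  cases N with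
  | zero => simp [desXY, evDes]
  | succ N => rw [evDes_ofFn, List.ofFn_succ, evDes]; simp

/-- permutations' of finRange versus Perm. -/
lemma perms_fin (N : ℕ) :
    (List.permutations' (List.finRange N)).Perm
      ((Finset.univ : Finset (Equiv.Perm (Fin N))).toList.map
        (fun σ : Equiv.Perm (Fin N) => List.ofFn (fun i => σ i))) := by
  rw [List.perm_ext_iff_of_nodup]
  · intro l
    simp only [List.mem_permutations', List.mem_map, Finset.mem_toList, Finset.mem_univ, true_and]
    constructor
    · intro h
      have hlen : l.length = N := by simpa using h.length_eq
      have hnd : l.Nodup := h.nodup_iff.2 (List.nodup_finRange N)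
      have hinj : Function.Injective (fun i : Fin N => l.get (i.cast hlen.symm)) := by
        intro a b hab
        have := List.nodup_iff_injective_get.1 hnd hab
        simpa [Fin.ext_iff] using this
      refine ⟨Equiv.ofBijective _ (Finite.injective_iff_bijective.1 hinj), ?_⟩
      apply List.ext_getElem
      · simp [hlen]
      · intro i h1 h2
        simp
    · rintro ⟨σ, rfl⟩
      rw [List.perm_ext_iff_of_nodup (List.nodup_ofFn.2 σ.injective) (List.nodup_finRange N)]
      intro a
      simp only [List.mem_ofFn, List.mem_finRange, iff_true]
      exact σ.surjective a
  · exact (List.permutations_perm_permutations' _).nodup_iff.1 (List.nodup_permutations _ (List.nodup_finRange N))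
  · refine (Finset.nodup_toList _).map ?_
    intro σ τ h
    exact Equiv.coe_fn_injective (List.ofFn_injective h)

lemma card_filter_eq_count {α : Type*} (S : Finset α) (f : α → ℕ) (s : ℕ) :
    (S.filter (fun a => f a = s)).card = (S.toList.map f).count s := by
  rw [List.count, List.countP_map, List.countP_eq_length_filter, ← Finset.length_toList]
  have : ((S.filter (fun a => f a = s)).toList).Perm (S.toList.filter ((fun x => x == s) ∘ f)) := by
    rw [List.perm_ext_iff_of_nodup (Finset.nodup_toList _) ((Finset.nodup_toList _).filter _)]
    intro a; simp
  exact this.length_eq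

lemma card_perm_eq_lcount {N : ℕ} (g : Fin N → ℕ) (s : ℕ) :
    (Finset.univ.filter (fun σ : Equiv.Perm (Fin N) =>
      desXY {x : ℕ | 0 < x ∧ 2 ∣ x} Set.univ (fun i => g (σ i)) = s)).card =
      lcount (List.ofFn g) s := by
  rw [card_filter_eq_count]
  unfold lcount
  rw [List.ofFn_eq_map, ← List.map_permutations', List.map_map]
  refine List.Perm.count_eq ?_ s
  refine List.Perm.trans ?_ ((perms_fin N).map _).symm
  rw [List.map_map]
  refine List.Perm.of_eq (List.map_congr_left ?_)
  intro σ _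
  simp only [desXY_eq, Function.comp_apply, List.map_ofFn]
  rfl

lemma fiber_card (k m j : ℕ) (hk : 1 ≤ k) (N : ℕ) (hN : N = k * m) :
    (Finset.univ.filter (fun i : Fin N => i.1 / k + 1 = j)).card =
      if 1 ≤ j ∧ j ≤ m then k else 0 := by
  subst hN
  split_ifs with h
  · symm
    obtain ⟨j, rfl⟩ : ∃ j', j = j' + 1 := ⟨j - 1, by omega⟩
    have hle : k * j + k ≤ k * m := by
      calc k * j + k = k * (j + 1) := by ring
        _ ≤ k * m := Nat.mul_le_mul_left _ h.2
    have := Finset.card_bij (s := (Finset.univ : Finset (Fin k)))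
      (t := Finset.univ.filter (fun i : Fin (k * m) => i.1 / k + 1 = j + 1))
      (fun c _ => (⟨k * j + c.1, by omega⟩ : Fin (k * m)))
      (by
        intro c _
        simp only [Finset.mem_filter, Finset.mem_univ, true_and]
        rw [Nat.mul_add_div (by omega), Nat.div_eq_of_lt c.2])
      (by
        intro a _ b _ h
        simp only [Fin.mk.injEq] at h
        exact Fin.ext (by omega))
      (by
        intro b hb
        simp only [Finset.mem_filter, Finset.mem_univ, true_and] at hb
        have hb' : b.1 / k = j := by omega
        refine ⟨⟨b.1 % k, Nat.mod_lt _ (by omega)⟩, Finset.mem_univ _, ?_⟩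
        apply Fin.ext
        have := Nat.div_add_mod b.1 k
        rw [hb'] at this
        exact this)
    simpa using this
  · rw [Finset.card_eq_zero, Finset.filter_eq_empty_iff]
    intro i _ hi
    apply h
    have : i.1 / k < m := Nat.div_lt_of_lt_mul i.2
    generalize i.1 / k = q at *
    omega

lemma count_lists (k n j : ℕ) :
    (evl k n ++ odl k n).count j = if 1 ≤ j ∧ j ≤ 2 * n then k else 0 := by
  induction n with
  | zero => simp [evl, odl]; omega
  | succ n ih =>
    rw [List.count_append] at ih
    simp only [evl, odl, List.count_append, List.count_replicate, beq_iff_eq]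
    have : List.count j (evl k n) + List.count j (odl k n) = if 1 ≤ j ∧ j ≤ 2 * n then k else 0 := ih
    split_ifs at * <;> omega

lemma ofFn_perm (k n N : ℕ) (hk : 1 ≤ k) (hN : N = 2 * k * n) :
    (List.ofFn (fun i : Fin N => i.1 / k + 1)).Perm (evl k n ++ odl k n) := by
  rw [List.perm_iff_count]
  intro j
  rw [count_lists, ← fiber_card k (2 * n) j hk N (by rw [hN]; ring), card_filter_eq_count]
  refine List.Perm.count_eq ?_ j
  rw [List.ofFn_eq_map]
  refine List.Perm.map _ ?_
  rw [List.perm_ext_iff_of_nodup (List.nodup_finRange N) (Finset.nodup_toList _)]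
  simp

/-- number of labelings of a word. -/
lemma labelings (k n N : ℕ) (hk : 1 ≤ k) (hN : N = 2 * k * n) (w : Fin N → ℕ)
    (h1 : ∀ i, 1 ≤ w i ∧ w i ≤ 2 * n)
    (h2 : ∀ j, 1 ≤ j → j ≤ 2 * n → (Finset.univ.filter (fun i => w i = j)).card = k) :
    (Finset.univ.filter (fun σ : Equiv.Perm (Fin N) =>
      (fun i => (σ i).1 / k + 1) = w)).card = (Nat.factorial k) ^ (2 * n) := by
  have hN' : N = k * (2 * n) := by rw [hN]; ring
  have hlt : ∀ i : Fin N, i.1 / k < 2 * n := fun i =>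
    Nat.div_lt_of_lt_mul (by have := i.2; omega)
  -- reference map into `Fin (2n)`
  let g : Fin N → Fin (2 * n) := fun i => ⟨i.1 / k, hlt i⟩
  let v : Fin N → Fin (2 * n) := fun i => ⟨w i - 1, by have := h1 i; omega⟩
  have hg : ∀ j : Fin (2 * n), Fintype.card {i // g i = j} = k := by
    intro j
    have := fiber_card k (2 * n) (j.1 + 1) hk N hN'
    rw [if_pos (by have := j.2; omega)] at this
    rw [Fintype.card_subtype, ← this]
    congr 1
    ext i
    simp [g, Fin.ext_iff]
  have hv : ∀ j : Fin (2 * n), Fintype.card {i // v i = j} = k := by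
    intro j
    have := h2 (j.1 + 1) (by omega) (by have := j.2; omega)
    rw [Fintype.card_subtype, ← this]
    congr 1
    ext i
    have := h1 i
    simp [v, Fin.ext_iff]
    omega
  -- an existing labeling
  have e : ∀ j, {i // v i = j} ≃ {i // g i = j} := fun j =>
    Fintype.equivOfCardEq (by rw [hg, hv])
  let τ : Equiv.Perm (Fin N) :=
    ((Equiv.sigmaFiberEquiv v).symm.trans (Equiv.sigmaCongrRight e)).trans (Equiv.sigmaFiberEquiv g)
  have hτ : ∀ i, g (τ i) = v i := fun i => (e (v i) ⟨i, rfl⟩).2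
  have hst := DomMulAct.stabilizer_card g
  have hcard : Fintype.card {σ : Equiv.Perm (Fin N) // g ∘ σ = g} = (Nat.factorial k) ^ (2 * n) := by
    rw [hst]
    simp [hg]
  rw [← hcard, Fintype.card_subtype]
  refine Finset.card_bij (fun σ _ => τ⁻¹.trans σ) ?_ ?_ ?_
  · intro σ hσ
    simp only [Finset.mem_filter, Finset.mem_univ, true_and] at hσ ⊢
    ext i
    have h3 := congrFun hσ (τ⁻¹ i)
    have h4 := congrArg Fin.val (hτ (τ⁻¹ i))
    rw [show τ (τ⁻¹ i) = i from τ.apply_symm_apply i] at h4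
    have h5 : (g i).1 = w (τ⁻¹ i) - 1 := h4
    show (σ (τ⁻¹ i)).1 / k = (g i).1
    have h6 : (σ (τ⁻¹ i)).1 / k + 1 = w (τ⁻¹ i) := h3
    rw [h5, ← h6, Nat.add_sub_cancel]
  · intro a _ b _ h
    ext1 i
    have := congrArg (fun f : Equiv.Perm (Fin N) => f (τ i)) h
    simpa using this
  · intro σ hσ
    refine ⟨τ.trans σ, ?_, ?_⟩
    · simp only [Finset.mem_filter, Finset.mem_univ, true_and] at hσ ⊢
      ext i
      have h3 := congrArg Fin.val (congrFun hσ (τ i))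
      have h4 := congrArg Fin.val (hτ i)
      have := h1 i
      simp only [g, v, Function.comp_apply, Equiv.trans_apply] at h3 h4 ⊢
      omega
    · ext1 i
      simp

lemma wordCount_lcount (k n s N : ℕ) (hk : 1 ≤ k) (hN : N = 2 * k * n) :
    (Nat.factorial k) ^ (2 * n) *
        wordCount {x : ℕ | 0 < x ∧ 2 ∣ x} Set.univ N (2 * n) (fun _ => k) s =
      lcount (evl k n ++ odl k n) s := by
  rw [← lcount_perm (ofFn_perm k n N hk hN), ← card_perm_eq_lcount]
  unfold wordCount
  set W : Set (Fin N → ℕ) := {w | (∀ i, 1 ≤ w i ∧ w i ≤ 2 * n) ∧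
    (∀ j, 1 ≤ j → j ≤ 2 * n → (Finset.univ.filter (fun i => w i = j)).card = k) ∧
    desXY {x : ℕ | 0 < x ∧ 2 ∣ x} Set.univ w = s} with hW
  have hfin : W.Finite := by
    refine Set.Finite.subset (Set.Finite.pi' (fun _ : Fin N => Set.finite_Icc 1 (2 * n))) ?_
    intro w hw i
    exact hw.1 i
  rw [Set.ncard_eq_toFinset_card W hfin]
  rw [Finset.card_eq_sum_card_fiberwise (t := hfin.toFinset)
    (f := fun σ : Equiv.Perm (Fin N) => fun i => (σ i).1 / k + 1)]
  · rw [Finset.sum_congr rfl (g := fun _ => (Nat.factorial k) ^ (2 * n))]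
    · simp [mul_comm]
    · intro w hw
      rw [Set.Finite.mem_toFinset] at hw
      rw [← labelings k n N hk hN w hw.1 hw.2.1]
      congr 1
      ext σ
      simp only [Finset.mem_filter, Finset.mem_univ, true_and]
      constructor
      · exact fun h => h.2
      · intro h
        refine ⟨?_, h⟩
        rw [h]; exact hw.2.2
  · intro σ hσ
    simp only [Finset.coe_filter, Finset.mem_univ, true_and, Set.mem_ofPred_eq] at hσ
    have hN' : N = k * (2 * n) := by rw [hN]; ring
    rw [Finset.mem_coe, Set.Finite.mem_toFinset]
    refine ⟨fun i => ?_, fun j hj1 hj2 => ?_, hσ⟩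
    · have : (σ i).1 / k < 2 * n := Nat.div_lt_of_lt_mul (by have := (σ i).2; omega)
      show 1 ≤ (σ i).1 / k + 1 ∧ (σ i).1 / k + 1 ≤ 2 * n
      generalize (σ i).1 / k = q at *
      omega
    · have := fiber_card k (2 * n) j hk N hN'
      rw [if_pos ⟨hj1, hj2⟩] at this
      refine Eq.trans ?_ this
      refine Finset.card_bij (fun i _ => σ i) ?_ ?_ ?_
      · intro i hi; simpa using hi
      · intro a _ b _ h; exact σ.injective h
      · intro b hb; exact ⟨σ.symm b, by simpa using hb, by simp⟩

theorem stmt19 (k n s : ℕ) (hk : 1 ≤ k) (hn : 1 ≤ n) :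
    (Nat.factorial k) ^ (2 * n) *
        wordCount {x : ℕ | 0 < x ∧ 2 ∣ x} Set.univ (2 * k * n) (2 * n) (fun _ => k) s =
      permCount {x : ℕ | 0 < x ∧ 2 ∣ x} Set.univ (2 * k * n) s := by
  rw [wordCount_lcount k n s _ hk rfl, lcount_eq,
    ← lcount_perm (ofFn_perm 1 (k * n) (2 * k * n) le_rfl (by ring)), ← card_perm_eq_lcount]
  unfold permCount
  simp only [Nat.div_one]
end
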